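/- Let Ξ be a finite subset of a d-dimensional real vector space M whose convex hull is d-dimensional, and suppose Ξ_{λ>0} := {χ ∈ Ξ : λ(χ) > 0} is maximal among the sets Ξ_{μ>0} over all nonzero linear functionals μ. Then there exists a linear functional λ' such that Ξ_{λ'>0} = Ξ_{λ>0} and the minimum value of λ' over Ξ_{λ'>0} is attained at d linearly independent elements of Ξ_{λ'>0}. -/

import Mathlib

/-- A functional that is nonpositive on `Ξ` vanishes, as `0` is interior to the hull. -/
lemma dual_eq_zero_of_nonpos {M : Type*} [NormedAddCommGroup M] [NormedSpace ℝ M]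
    [FiniteDimensional ℝ M]
    (Ξ : Finset M) (h0 : (0 : M) ∈ interior (convexHull ℝ (Ξ : Set M)))
    (ν : Module.Dual ℝ M) (h : ∀ χ ∈ Ξ, ν χ ≤ 0) : ν = 0 := by
  have hull : ∀ x ∈ convexHull ℝ (Ξ : Set M), ν x ≤ 0 := by
    intro x hx
    exact convexHull_min (t := {x | ν x ≤ 0}) (fun χ hχ => h χ hχ)
      (convex_halfSpace_le ν.isLinear 0) hx
  have key : ∀ v, ν v ≤ 0 := by
    intro v
    have hn : ∀ᶠ x in nhds (0 : M), ν x ≤ 0 :=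
      Filter.mem_of_superset (mem_interior_iff_mem_nhds.mp h0) hull
    have ht : Filter.Tendsto (fun t : ℝ => t • v) (nhdsWithin 0 (Set.Ioi 0)) (nhds 0) := by
      have : Filter.Tendsto (fun t : ℝ => t • v) (nhds 0) (nhds ((0 : ℝ) • v)) :=
        (continuous_id.smul continuous_const).tendsto 0
      rw [zero_smul] at this
      exact this.mono_left nhdsWithin_le_nhds
    obtain ⟨t, h1, h2⟩ := ((ht.eventually hn).and self_mem_nhdsWithin).exists
    have h2 : 0 < t := h2
    rw [map_smul, smul_eq_mul] at h1
    by_contra hc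
    push Not at hc
    nlinarith [mul_pos h2 hc]
  ext v
  have h1 := key v
  have h2 := key (-v)
  rw [map_neg] at h2
  simp only [LinearMap.zero_apply]
  linarith

/-- A polyhedron `{μ ≥ 1 on S}` with `S` spanning has a vertex. -/
lemma exists_vertex {M : Type*} [AddCommGroup M] [Module ℝ M]
    (S : Finset M) (hS : ∀ ν : Module.Dual ℝ M, (∀ χ ∈ S, ν χ = 0) → ν = 0)
    (μ₀ : Module.Dual ℝ M) (hμ₀ : ∀ χ ∈ S, 1 ≤ μ₀ χ) :
    ∃ μ : Module.Dual ℝ M, (∀ χ ∈ S, 1 ≤ μ χ) ∧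
      Submodule.span ℝ {χ : M | χ ∈ S ∧ μ χ = 1} = ⊤ := by
  classical
  induction hn : S.card - (S.filter (fun χ => μ₀ χ = 1)).card using Nat.strong_induction_on
    generalizing μ₀ with
  | _ n ih =>
  by_cases hsp : Submodule.span ℝ {χ : M | χ ∈ S ∧ μ₀ χ = 1} = ⊤
  · exact ⟨μ₀, hμ₀, hsp⟩
  obtain ⟨ν, hν0, hν⟩ := Submodule.exists_le_ker_of_lt_top _ (lt_top_iff_ne_top.mpr hsp)
  have hact : ∀ χ ∈ S, μ₀ χ = 1 → ν χ = 0 := fun χ h1 h2 =>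
    hν (Submodule.subset_span ⟨h1, h2⟩)
  obtain ⟨ν, hact, χ₁, hχ₁, hneg⟩ : ∃ ν : Module.Dual ℝ M,
      (∀ χ ∈ S, μ₀ χ = 1 → ν χ = 0) ∧ ∃ χ ∈ S, ν χ < 0 := by
    have : ∃ χ ∈ S, ν χ ≠ 0 := by
      by_contra hc
      push Not at hc
      exact hν0 (hS ν hc)
    obtain ⟨χ, hχ, hne⟩ := this
    rcases lt_or_gt_of_ne hne with h | h
    · exact ⟨ν, hact, χ, hχ, h⟩
    · exact ⟨-ν, fun χ h1 h2 => by simp [hact χ h1 h2], χ, hχ, by simpa using h⟩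
  obtain ⟨χ₂, hχ₂, hmin⟩ := Finset.exists_min_image (S.filter (fun χ => ν χ < 0))
    (fun χ => (μ₀ χ - 1) / (-ν χ)) ⟨χ₁, by simp [hχ₁, hneg]⟩
  rw [Finset.mem_filter] at hχ₂
  obtain ⟨hχ₂, hneg₂⟩ := hχ₂
  set t := (μ₀ χ₂ - 1) / (-ν χ₂) with ht
  have ht0 : 0 ≤ t := div_nonneg (by linarith [hμ₀ _ hχ₂]) (by linarith)
  have hP : ∀ χ ∈ S, 1 ≤ (μ₀ + t • ν) χ := by
    intro χ hχ
    simp only [LinearMap.add_apply, LinearMap.smul_apply, smul_eq_mul]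
    have h1 := hμ₀ χ hχ
    by_cases hc : ν χ < 0
    · have h2 := hmin χ (by simp [hχ, hc])
      rw [le_div_iff₀ (by linarith)] at h2
      linarith
    · push Not at hc
      nlinarith [mul_nonneg ht0 hc]
  have heq : (μ₀ + t • ν) χ₂ = 1 := by
    simp only [LinearMap.add_apply, LinearMap.smul_apply, smul_eq_mul]
    have : t * (-ν χ₂) = μ₀ χ₂ - 1 := div_mul_cancel₀ _ (by linarith)
    linarith
  have hlt : (S.filter (fun χ => μ₀ χ = 1)).card
      < (S.filter (fun χ => (μ₀ + t • ν) χ = 1)).card := by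
    apply Finset.card_lt_card
    rw [Finset.ssubset_iff_of_subset]
    · refine ⟨χ₂, by rw [Finset.mem_filter]; exact ⟨hχ₂, heq⟩, ?_⟩
      rw [Finset.mem_filter]
      rintro ⟨_, h⟩
      exact hneg₂.ne (hact _ hχ₂ h)
    · intro χ hχ
      rw [Finset.mem_filter] at hχ ⊢
      refine ⟨hχ.1, ?_⟩
      simp [hact χ hχ.1 hχ.2, hχ.2]
  have hle : (S.filter (fun χ => (μ₀ + t • ν) χ = 1)).card ≤ S.card :=
    Finset.card_filter_le _ _
  exact ih _ (by omega) (μ₀ + t • ν) hP rfl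

/-- If `conv(Ξ)` is full-dimensional with `0` in its interior and `Ξ_{λ>0}` is a
maximal unstable state, then there is `λ'` with `Ξ_{λ'>0} = Ξ_{λ>0}` whose minimum on
`Ξ_{λ'>0}` is attained at `d` linearly independent elements. -/
theorem stmt4 {M : Type*} [NormedAddCommGroup M] [NormedSpace ℝ M] [FiniteDimensional ℝ M]
    (Ξ : Finset M) (h0 : (0 : M) ∈ interior (convexHull ℝ (Ξ : Set M)))
    (lam : Module.Dual ℝ M) (hlam : lam ≠ 0)
    (hmax : ∀ μ : Module.Dual ℝ M, μ ≠ 0 →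
      {χ : M | χ ∈ Ξ ∧ 0 < lam χ} ⊆ {χ : M | χ ∈ Ξ ∧ 0 < μ χ} →
      {χ : M | χ ∈ Ξ ∧ 0 < lam χ} = {χ : M | χ ∈ Ξ ∧ 0 < μ χ}) :
    ∃ lam' : Module.Dual ℝ M,
      {χ : M | χ ∈ Ξ ∧ 0 < lam' χ} = {χ : M | χ ∈ Ξ ∧ 0 < lam χ} ∧
      ∃ c : ℝ, (∀ χ ∈ Ξ, 0 < lam' χ → c ≤ lam' χ) ∧
        ∃ χs : Fin (Module.finrank ℝ M) → M, LinearIndependent ℝ χs ∧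
          ∀ i, χs i ∈ Ξ ∧ 0 < lam' (χs i) ∧ lam' (χs i) = c := by
  classical
  set S := Ξ.filter (fun χ => 0 < lam χ) with hSdef
  have hSm : ∀ χ, χ ∈ S ↔ χ ∈ Ξ ∧ 0 < lam χ := fun χ => by rw [hSdef, Finset.mem_filter]
  have hSne : S.Nonempty := by
    by_contra hc
    rw [Finset.not_nonempty_iff_eq_empty] at hc
    apply hlam
    apply dual_eq_zero_of_nonpos Ξ h0
    intro χ hχ
    by_contra h
    push Not at h
    have := (hSm χ).2 ⟨hχ, h⟩
    simp [hc] at this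
  have hP : ∀ μ : Module.Dual ℝ M, (∀ χ ∈ S, 0 < μ χ) →
      {χ : M | χ ∈ Ξ ∧ 0 < lam χ} = {χ : M | χ ∈ Ξ ∧ 0 < μ χ} := by
    intro μ hμ
    apply hmax
    · rintro rfl
      obtain ⟨χ, hχ⟩ := hSne
      simpa using hμ χ hχ
    · intro χ hχ
      exact ⟨hχ.1, hμ χ ((hSm χ).2 hχ)⟩
  have hspan : ∀ ν : Module.Dual ℝ M, (∀ χ ∈ S, ν χ = 0) → ν = 0 := by
    intro ν hν
    apply dual_eq_zero_of_nonpos Ξ h0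
    intro χ hχ
    by_cases hs : χ ∈ S
    · exact (hν χ hs).le
    by_contra hc
    push Not at hc
    have hl : lam χ ≤ 0 := by
      by_contra h
      exact hs ((hSm χ).2 ⟨hχ, not_le.mp h⟩)
    have h1 := hP (lam + ((1 - lam χ) / ν χ) • ν) (fun ψ hψ => by
      simpa [hν ψ hψ] using ((hSm ψ).1 hψ).2)
    have h2 : χ ∈ {χ : M | χ ∈ Ξ ∧ 0 < lam χ} := by
      rw [h1]
      refine ⟨hχ, ?_⟩
      simp only [LinearMap.add_apply, LinearMap.smul_apply, smul_eq_mul]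
      rw [div_mul_cancel₀ _ hc.ne']
      linarith
    exact absurd h2.2 (not_lt.mpr hl)
  obtain ⟨χ₀, hχ₀, hmin⟩ := Finset.exists_min_image S lam hSne
  have hpos : 0 < lam χ₀ := ((hSm _).1 hχ₀).2
  obtain ⟨μ, hμ, htop⟩ := exists_vertex S hspan ((lam χ₀)⁻¹ • lam) (fun χ hχ => by
    simp only [LinearMap.smul_apply, smul_eq_mul]
    rw [← inv_mul_cancel₀ hpos.ne']
    exact mul_le_mul_of_nonneg_left (hmin χ hχ) (inv_nonneg.mpr hpos.le))
  have hE := hP μ (fun χ hχ => lt_of_lt_of_le one_pos (hμ χ hχ))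
  refine ⟨μ, hE.symm, 1, ?_, ?_⟩
  · intro χ hχ h
    have : χ ∈ {χ : M | χ ∈ Ξ ∧ 0 < lam χ} := by rw [hE]; exact ⟨hχ, h⟩
    exact hμ χ ((hSm χ).2 this)
  · obtain ⟨f, hf, -, hli⟩ :=
      Submodule.exists_fun_fin_finrank_span_eq ℝ {χ : M | χ ∈ S ∧ μ χ = 1}
    have hd : Module.finrank ℝ M
        = Module.finrank ℝ (Submodule.span ℝ {χ : M | χ ∈ S ∧ μ χ = 1}) := by
      rw [htop, finrank_top]
    refine ⟨f ∘ Fin.cast hd, hli.comp _ (Fin.cast_injective hd), fun i => ?_⟩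
    have h := hf (Fin.cast hd i)
    exact ⟨((hSm _).1 h.1).1, by simp only [Function.comp]; rw [h.2]; exact one_pos, h.2⟩
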